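/- Let G=(V,E) be a finite simple graph with an independent set N ⊆ V and P = V∖N. Let B=(P,V,E_1) be the bipartite graph in which p ∈ P is adjacent to v ∈ V iff p=v or pv ∈ E, and let B_1 be the bipartite graph whose biadjacency matrix is the augmented adjacency matrix A(G) of G (rows and columns both indexed by V, entry 1 at (u,v) iff u=v or uv ∈ E). Let H_1(B_1) be the reduced associated graph of B_1: its vertices are the positions (u,v) with A(G)_{uv}=0 except those with both u,v ∈ N, and two positions (u,v),(u',v') are adjacent iff u≠u', v≠v', and A(G)_{uv'}=A(G)_{u'v}=1. Then G is a probe interval graph with probes P and nonprobes N if and only if (1) B is an interval bigraph, and (2) H_1(B_1) is a bipartite graph and admits a proper 2-coloring of its vertices by the symbols R and C such that the induced labeling of the zero entries of the biadjacency matrix of B (the positions (p,v) with p ∈ P) forms, for some orderings of the rows and columns, an R-C partition of the biadjacency matrix of B. -/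

import Mathlib

/-- A finite simple graph is a probe interval graph with probes `P` and nonprobes `N`
if `V` is partitioned into `P` and `N` and each vertex can be assigned a nonempty
closed real interval such that two distinct vertices are adjacent iff their
intervals intersect and at least one of them is a probe. -/
def IsProbeIntervalGraph {V : Type*} (G : SimpleGraph V) (P N : Set V) : Prop :=
  P ∪ N = Set.univ ∧ P ∩ N = ∅ ∧
  ∃ a b : V → ℝ, (∀ v, a v ≤ b v) ∧
    ∀ u v : V, u ≠ v →
      (G.Adj u v ↔
        ((Set.Icc (a u) (b u) ∩ Set.Icc (a v) (b v)).Nonempty ∧ (u ∈ P ∨ v ∈ P)))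

/-- A bipartite graph, given by a relation `E : X → Y → Prop`, is an interval bigraph
if each vertex can be assigned a nonempty closed real interval such that `x ∈ X` and
`y ∈ Y` are adjacent iff their intervals intersect. -/
def IsIntervalBigraph {X Y : Type*} (E : X → Y → Prop) : Prop :=
  ∃ (a b : X → ℝ) (c d : Y → ℝ), (∀ x, a x ≤ b x) ∧ (∀ y, c y ≤ d y) ∧
    ∀ (x : X) (y : Y),
      E x y ↔ (Set.Icc (a x) (b x) ∩ Set.Icc (c y) (d y)).Nonempty

/-- The augmented adjacency matrix of `G`: entry `(u,v)` is `1` iff `u = v` or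
`u` and `v` are adjacent. -/
def AugAdj {V : Type*} (G : SimpleGraph V) (u v : V) : Prop :=
  u = v ∨ G.Adj u v

/-- The vertex set of the reduced associated graph `H₁(B₁)`: zero positions of the
augmented adjacency matrix of `G` which are not indexed by two nonprobes. -/
def ReducedVertex {V : Type*} (G : SimpleGraph V) (N : Set V) (x : V × V) : Prop :=
  ¬ AugAdj G x.1 x.2 ∧ ¬ (x.1 ∈ N ∧ x.2 ∈ N)

/-- Adjacency in the (reduced) associated graph: two zero positions form a couple. -/
def Couple {V : Type*} (G : SimpleGraph V) (x y : V × V) : Prop :=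
  x.1 ≠ y.1 ∧ x.2 ≠ y.2 ∧ AugAdj G x.1 y.2 ∧ AugAdj G y.1 x.2

/-- A transitive irreflexive relation on a finite type admits a strictly monotone rank. -/
theorem exists_nat_rank {α : Type*} [Finite α] (r : α → α → Prop)
    (htrans : ∀ x y z, r x y → r y z → r x z) (hirr : ∀ x, ¬ r x x) :
    ∃ h : α → ℕ, ∀ x y, r x y → h x < h y := by
  refine ⟨fun x => {z | r z x}.ncard, fun x y hxy => ?_⟩
  refine Set.ncard_lt_ncard ⟨fun z hz => htrans z x y hz hxy, fun h => hirr x (h hxy)⟩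
    (Set.toFinite _)

/-- A finite type can be ordered injectively by `ℕ` so that a given real function is monotone. -/
theorem exists_injective_nat_monotone {α : Type*} [Finite α] (f : α → ℝ) :
    ∃ τ : α → ℕ, Function.Injective τ ∧ ∀ v w, τ v < τ w → f v ≤ f w := by
  obtain ⟨n, ⟨e⟩⟩ := Finite.exists_equiv_fin α
  obtain ⟨τ, hτ⟩ := exists_nat_rank
    (fun v w => f v < f w ∨ (f v = f w ∧ e v < e w)) (by grind) (by grind)
  refine ⟨τ, fun v w hvw => ?_, fun v w hvw => ?_⟩
  · by_contra hne
    have he : e v ≠ e w := fun h => hne (e.injective h)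
    rcases lt_trichotomy (f v) (f w) with h | h | h
    · exact (hτ v w (Or.inl h)).ne hvw
    · rcases lt_or_gt_of_ne he with h' | h'
      · exact (hτ v w (Or.inr ⟨h, h'⟩)).ne hvw
      · exact (hτ w v (Or.inr ⟨h.symm, h'⟩)).ne hvw.symm
    · exact (hτ w v (Or.inl h)).ne hvw.symm
  · by_contra h
    exact (hτ w v (Or.inl (not_le.mp h))).not_gt hvw

/-- If every chain of three steps of `T` can be shortened to two, then every chain can be
shortened to at most two steps. -/
theorem transGen_le_two_steps {α : Type*} {T : α → α → Prop}
    (hT : ∀ x y z w, T x y → T y z → T z w → ∃ t, T x t ∧ T t w) {x y : α}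
    (h : Relation.TransGen T x y) : T x y ∨ ∃ z, T x z ∧ T z y := by
  induction h with
  | single h => exact Or.inl h
  | tail _ hbc ih =>
    rcases ih with h | ⟨z, hxz, hzb⟩
    · exact Or.inr ⟨_, h, hbc⟩
    · exact Or.inr (hT _ _ _ _ hxz hzb hbc)

theorem icc_inter_icc_nonempty_iff {a b c d : ℝ} (hab : a ≤ b) (hcd : c ≤ d) :
    (Set.Icc a b ∩ Set.Icc c d).Nonempty ↔ a ≤ d ∧ c ≤ b := by
  rw [Set.Icc_inter_Icc, Set.nonempty_Icc]
  simp only [sup_le_iff, le_inf_iff]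
  tauto

theorem AugAdj.symm {V : Type*} {G : SimpleGraph V} {u v : V} (h : AugAdj G u v) :
    AugAdj G v u :=
  h.imp Eq.symm SimpleGraph.Adj.symm

/-- Real intervals realising a precedence relation `L` (disjoint, in this order) and a reflexive
symmetric relation `A` (intersecting) on a finite type, provided that alternating cycles of `L`
and `A` of length at most two are excluded and longer ones can be shortened. -/
theorem exists_intervals_of_precedence {V : Type*} [Finite V] {L A : V → V → Prop}
    (hrefl : ∀ v, A v v) (hsymm : ∀ u v, A u v → A v u)
    (hdisj : ∀ u v, L u v → ¬ A u v)
    (hcouple : ∀ x y x' y', L x y → A y x' → L x' y' → ¬ A y' x)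
    (hshort : ∀ x y x' y' x'' y'', L x y → A y x' → L x' y' → A y' x'' → L x'' y'' →
      L x y' ∨ L x' y'') :
    ∃ a b : V → ℝ, (∀ v, a v ≤ b v) ∧ (∀ u v, L u v → b u < a v) ∧
      ∀ u v, A u v → a u ≤ b v := by
  let T : V → V → Prop := fun x x' => ∃ y, L x y ∧ A y x'
  have hT : ∀ x y z w, T x y → T y z → T z w → ∃ t, T x t ∧ T t w := by
    rintro x₁ x₂ x₃ x₄ ⟨y₁, h₁, g₁⟩ ⟨y₂, h₂, g₂⟩ ⟨y₃, h₃, g₃⟩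
    rcases hshort _ _ _ _ _ _ h₁ g₁ h₂ g₂ h₃ with h | h
    · exact ⟨x₃, ⟨y₂, h, g₂⟩, ⟨y₃, h₃, g₃⟩⟩
    · exact ⟨x₂, ⟨y₁, h₁, g₁⟩, ⟨y₃, h, g₃⟩⟩
  obtain ⟨h, hh⟩ := exists_nat_rank (Relation.TransGen T)
    (fun _ _ _ => Relation.TransGen.trans) (fun x hx => by
      rcases transGen_le_two_steps hT hx with ⟨y, hL, hA⟩ | ⟨z, ⟨y, hL, hA⟩, ⟨y', hL', hA'⟩⟩
      · exact hdisj _ _ hL (hsymm _ _ hA)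
      · exact hcouple _ _ _ _ hL hA hL' hA')
  have hne : ∀ v, (h '' {x | A v x}).Nonempty := fun v => ⟨h v, v, hrefl v, rfl⟩
  refine ⟨fun v => (sInf (h '' {x | A v x}) : ℕ), fun v => h v, fun v => ?_, fun u v huv => ?_,
    fun u v huv => ?_⟩
  · exact Nat.cast_le.mpr (Nat.sInf_le ⟨v, hrefl v, rfl⟩)
  · obtain ⟨x, hx, hxe⟩ := Nat.sInf_mem (hne v)
    dsimp only
    rw [← hxe]
    exact_mod_cast hh u x (Relation.TransGen.single ⟨v, huv, hx⟩)
  · exact Nat.cast_le.mpr (Nat.sInf_le ⟨v, huv, rfl⟩)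

/-- `G` with independent set `N` and `P = V ∖ N` is a probe interval graph
with probes `P` and nonprobes `N` iff (1) the bigraph `B = (P, V, E₁)` is an interval
bigraph, and (2) the reduced associated graph `H₁(B₁)` is bipartite, admitting a proper
2-coloring `c` of its vertices by the symbols `R` (= `true`) and `C` (= `false`) whose
induced labeling of the zero entries of the biadjacency matrix of `B` forms, for some
orderings of the rows (`σ : P → ℕ` injective) and columns (`τ : V → ℕ` injective), an
R-C partition of the biadjacency matrix of `B`. -/
theorem probeIntervalGraph_iff_reduced_associated_graph_bipartite
    {V : Type*} [Fintype V] (G : SimpleGraph V) (N : Set V)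
    (hN : ∀ u ∈ N, ∀ v ∈ N, ¬ G.Adj u v) :
    IsProbeIntervalGraph G Nᶜ N ↔
      (IsIntervalBigraph
          (fun (p : ↥(Nᶜ)) (v : V) => (p : V) = v ∨ G.Adj (p : V) v) ∧
        ∃ c : V × V → Bool,
          (∀ x y : V × V, ReducedVertex G N x → ReducedVertex G N y →
            Couple G x y → c x ≠ c y) ∧
          ∃ (σ : ↥(Nᶜ) → ℕ) (τ : V → ℕ),
            Function.Injective σ ∧ Function.Injective τ ∧
            (∀ (p : ↥(Nᶜ)) (v w : V), ¬ AugAdj G (p : V) v → c ((p : V), v) = true →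
              τ v < τ w → ¬ AugAdj G (p : V) w ∧ c ((p : V), w) = true) ∧
            (∀ (p q : ↥(Nᶜ)) (v : V), ¬ AugAdj G (p : V) v → c ((p : V), v) = false →
              σ p < σ q → ¬ AugAdj G (q : V) v ∧ c ((q : V), v) = false)) := by
  constructor
  · rintro ⟨-, -, a, b, hab, hG⟩
    have haug : ∀ u v, ¬ (u ∈ N ∧ v ∈ N) → (AugAdj G u v ↔ a u ≤ b v ∧ a v ≤ b u) := by
      intro u v huv
      by_cases h : u = v
      · subst h
        simp [AugAdj, hab]
      · have hP : u ∈ Nᶜ ∨ v ∈ Nᶜ := by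
          simp only [Set.mem_compl_iff]
          tauto
        have := hG u v h
        rw [icc_inter_icc_nonempty_iff (hab u) (hab v)] at this
        rw [AugAdj, this]
        tauto
    have hmeet : ∀ u v, AugAdj G u v → a u ≤ b v ∧ a v ≤ b u := by
      rintro u v (rfl | h)
      · exact ⟨hab u, hab u⟩
      · exact (haug u v fun g => hN u g.1 v g.2 h).mp (Or.inr h)
    have hprobe : ∀ (p : ↥(Nᶜ)) v, AugAdj G (p : V) v ↔ a p ≤ b v ∧ a v ≤ b p :=
      fun p v => haug p v fun h => p.2 h.1
    refine ⟨⟨fun p => a p, fun p => b p, a, b, fun p => hab p, hab, fun p v => ?_⟩, ?_⟩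
    · rw [icc_inter_icc_nonempty_iff (hab p) (hab v)]
      exact hprobe p v
    obtain ⟨σ, hσ, hσa⟩ := exists_injective_nat_monotone fun p : ↥(Nᶜ) => a p
    obtain ⟨τ, hτ, hτa⟩ := exists_injective_nat_monotone a
    refine ⟨fun x => decide (b x.1 < a x.2), ?_, σ, τ, hσ, hτ, ?_, ?_⟩
    · rintro ⟨u, v⟩ ⟨u', v'⟩ ⟨hx, hxN⟩ ⟨hy, hyN⟩ ⟨-, -, h₁, h₂⟩ hc
      rw [haug _ _ hxN] at hx
      rw [haug _ _ hyN] at hy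
      have huv' := hmeet _ _ h₁
      have hu'v := hmeet _ _ h₂
      have := hab u
      have := hab u'
      have := hab v
      have := hab v'
      simp only [decide_eq_decide] at hc
      grind
    · intro p v w hv hc hvw
      simp only [decide_eq_true_eq] at hc ⊢
      have := hτa v w hvw
      rw [hprobe]
      grind
    · intro p q v hv hc hpq
      simp only [decide_eq_false_iff_not] at hc ⊢
      rw [hprobe] at hv ⊢
      have := hσa p q hpq
      have := hab q
      have := hab v
      grind
  · rintro ⟨-, c, hc, σ, τ, hσ, hτ, hR, hC⟩
    let L : V → V → Prop := fun u v => ReducedVertex G N (u, v) ∧ c (u, v) = true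
    have hL : ∀ u v, L u v → ¬ AugAdj G u v := fun u v h => h.1.1
    have hLN : ∀ u v, L u v → u ∈ N → v ∉ N := fun u v h hu hv => h.1.2 ⟨hu, hv⟩
    have hAN : ∀ u v, AugAdj G u v → u ∈ N → v ∈ N → u = v :=
      fun u v h hu hv => h.resolve_right (hN u hu v hv)
    have hswap : ∀ u v, ReducedVertex G N (u, v) → c (u, v) ≠ c (v, u) := by
      intro u v h
      have hne : u ≠ v := fun e => h.1 (Or.inl e)
      exact hc _ _ h ⟨fun h' => h.1 h'.symm, fun h' => h.2 h'.symm⟩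
        ⟨hne, hne.symm, Or.inl rfl, Or.inl rfl⟩
    have htotal : ∀ u v, ¬ AugAdj G u v → ¬ (u ∈ N ∧ v ∈ N) → L u v ∨ L v u := by
      intro u v h h'
      have hs := hswap u v ⟨h, h'⟩
      cases hb : c (u, v)
      · exact Or.inr ⟨⟨fun g => h g.symm, fun g => h' g.symm⟩, by simpa [hb] using hs.symm⟩
      · exact Or.inl ⟨⟨h, h'⟩, hb⟩
    have hcouple : ∀ x y x' y', L x y → AugAdj G y x' → L x' y' → ¬ AugAdj G y' x := by
      intro x y x' y' h h₁ h' h₂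
      refine hc _ _ h.1 h'.1 ⟨?_, ?_, h₂.symm, h₁.symm⟩ (h.2.trans h'.2.symm)
      · rintro rfl
        exact hL _ _ h h₁.symm
      · rintro rfl
        exact hL _ _ h h₂.symm
    have hrow : ∀ p q v w, p ∉ N → q ∉ N → L p v → L q w → L p w ∨ L q v := by
      intro p q v w hp hq hpv hqw
      rcases lt_trichotomy (τ v) (τ w) with h | h | h
      · have := hR ⟨p, hp⟩ v w hpv.1.1 hpv.2 h
        exact Or.inl ⟨⟨this.1, fun g => hp g.1⟩, this.2⟩
      · exact Or.inl (hτ h ▸ hpv)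
      · have := hR ⟨q, hq⟩ w v hqw.1.1 hqw.2 h
        exact Or.inr ⟨⟨this.1, fun g => hq g.1⟩, this.2⟩
    have hbelow : ∀ p q v (hp : p ∈ Nᶜ) (hq : q ∈ Nᶜ),
        σ ⟨p, hp⟩ < σ ⟨q, hq⟩ → L v p → L v q := by
      intro p q v hp hq h hvp
      have hs := hswap v p hvp.1
      have := hC ⟨p, hp⟩ ⟨q, hq⟩ v (fun g => hvp.1.1 g.symm)
        (by simpa [hvp.2] using hs.symm) h
      have hs' := hswap q v ⟨this.1, fun g => hq g.1⟩
      exact ⟨⟨fun g => this.1 g.symm, fun g => hq g.2⟩, by simpa [this.2] using hs'.symm⟩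
    have hcol : ∀ p q v w, p ∉ N → q ∉ N → L v p → L w q → L v q ∨ L w p := by
      intro p q v w hp hq hvp hwq
      rcases lt_trichotomy (σ ⟨p, hp⟩) (σ ⟨q, hq⟩) with h | h | h
      · exact Or.inl (hbelow p q v hp hq h hvp)
      · obtain rfl : p = q := congrArg Subtype.val (hσ h)
        exact Or.inl hvp
      · exact Or.inr (hbelow q p w hq hp h hwq)
    have hstep : ∀ x y x' y', L x y → AugAdj G y x' → L x' y' → ¬ (x ∈ N ∧ y' ∈ N) →
        L x y' := by
      intro x y x' y' h h₁ h' hxy'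
      have hnot : ¬ L x' y := fun g => hL _ _ g h₁.symm
      by_cases hx : x ∉ N ∧ x' ∉ N
      · exact (hrow x x' y y' hx.1 hx.2 h h').resolve_right hnot
      by_cases hy : y ∉ N ∧ y' ∉ N
      · exact (hcol y y' x x' hy.1 hy.2 h h').resolve_right hnot
      have hxn : x ∉ N := by grind
      have hyn : y' ∉ N := by grind
      have hyx : y = x' := hAN y x' h₁ (by grind) (by grind)
      subst hyx
      have hna : ¬ AugAdj G x y' := fun g => hcouple x y y y' h h₁ h' g.symm
      refine (htotal x y' hna hxy').resolve_right fun g => ?_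
      rcases hrow x y' y x hxn hyn h g with g' | g'
      · exact hL _ _ g' (Or.inl rfl)
      · exact hcouple y y' y' y h' (Or.inl rfl) g' (Or.inl rfl)
    obtain ⟨a, b, hab, hLab, hAab⟩ := exists_intervals_of_precedence (L := L) (A := AugAdj G)
      (fun v => Or.inl rfl) (fun _ _ => AugAdj.symm) hL hcouple (by
        intro x y x' y' x'' y'' h h₁ h' h₂ h''
        by_cases hxy : x ∈ N ∧ y' ∈ N
        · refine Or.inr (hstep _ _ _ _ h' h₂ h'' fun g => ?_)
          exact hLN _ _ h' g.1 hxy.2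
        · exact Or.inl (hstep _ _ _ _ h h₁ h' hxy))
    refine ⟨Set.compl_union_self N, Set.compl_inter_self N, a, b, hab, fun u v huv => ?_⟩
    rw [icc_inter_icc_nonempty_iff (hab u) (hab v)]
    constructor
    · intro h
      refine ⟨⟨hAab u v (Or.inr h), hAab v u (Or.inr h.symm)⟩, ?_⟩
      by_contra hn
      simp only [Set.mem_compl_iff, not_or, not_not] at hn
      exact hN u hn.1 v hn.2 h
    · rintro ⟨⟨h₁, h₂⟩, hP⟩
      by_contra hn
      have hna : ¬ AugAdj G u v := fun g => g.elim huv hn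
      rcases htotal u v hna (fun g => hP.elim (· g.1) (· g.2)) with h | h
      · exact (hLab u v h).not_ge h₂
      · exact (hLab v u h).not_ge h₁
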